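/- If S : [0,1] → ℝ is continuously differentiable with |Ṡ|₁ = ∫₀¹ |Ṡ(t)| dt, then its Fourier coefficients θ_j = ∫₀¹ S(t)φ_j(t) dt with respect to the trigonometric basis satisfy sup_{l ≥ 2} l·∑_{j ≥ l} θ_j² ≤ 4|Ṡ|₁². -/

import Mathlib

open MeasureTheory Real Filter

/-- The trigonometric basis of `L²[0,1]` (indices `j ≥ 1`; the value at `j = 0` is a dummy). -/
noncomputable def phi (j : ℕ) (x : ℝ) : ℝ :=
  if j ≤ 1 then 1
  else if j % 2 = 0 then Real.sqrt 2 * Real.cos (2 * Real.pi * ((j / 2 : ℕ) : ℝ) * x)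
  else Real.sqrt 2 * Real.sin (2 * Real.pi * ((j / 2 : ℕ) : ℝ) * x)

/-- Fourier coefficients `θ_j = ∫₀¹ S(t) φ_j(t) dt`. -/
noncomputable def fourierCoef (S : ℝ → ℝ) (j : ℕ) : ℝ := ∫ t in (0:ℝ)..1, S t * phi j t

theorem abs_fourierCoef_le {S S' v : ℝ → ℝ} {j : ℕ} {B : ℝ}
    (hderiv : ∀ t ∈ Set.Icc (0:ℝ) 1, HasDerivWithinAt S (S' t) (Set.Icc (0:ℝ) 1) t)
    (hS'cont : ContinuousOn S' (Set.Icc (0:ℝ) 1))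
    (hv : ∀ t, HasDerivAt v (phi j t) t) (hphi : Continuous (phi j))
    (hv0 : v 0 = 0) (hv1 : v 1 = 0) (hB : ∀ t, |v t| ≤ B) :
    |fourierCoef S j| ≤ B * ∫ t in (0:ℝ)..1, |S' t| := by
  have hI : Set.uIcc (0:ℝ) 1 = Set.Icc 0 1 := Set.uIcc_of_le zero_le_one
  have hvc : Continuous v := continuous_iff_continuousAt.2 fun t => (hv t).continuousAt
  have hparts : fourierCoef S j = -∫ t in (0:ℝ)..1, S' t * v t := by
    rw [fourierCoef, intervalIntegral.integral_mul_deriv_eq_deriv_mul_of_hasDerivWithinAt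
      (u' := S') (v := v) (hI ▸ hderiv) (fun t _ => (hv t).hasDerivWithinAt)
      (ContinuousOn.intervalIntegrable (hI ▸ hS'cont)) (hphi.intervalIntegrable _ _), hv0, hv1]
    ring
  rw [hparts, abs_neg, ← intervalIntegral.integral_const_mul]
  refine (intervalIntegral.abs_integral_le_integral_abs zero_le_one).trans ?_
  refine intervalIntegral.integral_mono_on zero_le_one
    (ContinuousOn.intervalIntegrable (hI ▸ (hS'cont.mul hvc.continuousOn).abs))
    (ContinuousOn.intervalIntegrable (hI ▸ continuousOn_const.mul hS'cont.abs)) fun t _ => ?_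
  rw [abs_mul, mul_comm]
  gcongr
  exact hB t

theorem exists_antideriv_phi {j : ℕ} (hj : 2 ≤ j) :
    ∃ v : ℝ → ℝ, (∀ t, HasDerivAt v (phi j t) t) ∧ Continuous (phi j) ∧ v 0 = 0 ∧ v 1 = 0 ∧
      ∀ t, |v t| ≤ √2 / (π * (j / 2 : ℕ)) := by
  obtain ⟨k, hk⟩ : ∃ k, k = j / 2 := ⟨_, rfl⟩
  have hk0 : (0 : ℝ) < k := by
    have : 0 < k := by omega
    exact_mod_cast this
  have hc : 0 < 2 * π * k := by positivity
  have hB : √2 / (π * k) = √2 / (2 * π * k) * 2 := by field_simp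
  have hlin (t : ℝ) : HasDerivAt (fun x => 2 * π * k * x) (2 * π * k) t := by
    simpa using (hasDerivAt_id t).const_mul (2 * π * k)
  have hend : 2 * π * k * 1 = k * (2 * π) := by ring
  rw [← hk, hB]
  by_cases he : j % 2 = 0
  · have hphi : phi j = fun x => √2 * cos (2 * π * k * x) := by
      funext x
      rw [phi, if_neg (by omega), if_pos he, hk]
    refine ⟨fun x => √2 / (2 * π * k) * sin (2 * π * k * x), fun t => ?_, ?_, by simp, ?_,
      fun t => ?_⟩
    · rw [hphi]
      refine ((hlin t).sin.const_mul _).congr_deriv ?_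
      field_simp
    · rw [hphi]
      fun_prop
    · have := sin_nat_mul_two_pi_sub 0 k
      simp only [sub_zero, sin_zero, neg_zero] at this
      simp only [hend, this, mul_zero]
    · rw [abs_mul, abs_of_nonneg (by positivity)]
      gcongr
      linarith [abs_sin_le_one (2 * π * k * t)]
  · have hphi : phi j = fun x => √2 * sin (2 * π * k * x) := by
      funext x
      rw [phi, if_neg (by omega), if_neg he, hk]
    refine ⟨fun x => √2 / (2 * π * k) * (1 - cos (2 * π * k * x)), fun t => ?_, ?_, by simp, ?_,
      fun t => ?_⟩
    · rw [hphi]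
      refine (((hlin t).cos.const_sub 1).const_mul _).congr_deriv ?_
      field_simp
    · rw [hphi]
      fun_prop
    · simp only [hend, cos_nat_mul_two_pi, sub_self, mul_zero]
    · rw [abs_mul, abs_of_nonneg (by positivity)]
      gcongr
      rw [abs_le]
      constructor <;> linarith [neg_one_le_cos (2 * π * k * t), cos_le_one (2 * π * k * t)]

theorem fourierCoef_sq_le {S S' : ℝ → ℝ}
    (hderiv : ∀ t ∈ Set.Icc (0:ℝ) 1, HasDerivWithinAt S (S' t) (Set.Icc (0:ℝ) 1) t)
    (hS'cont : ContinuousOn S' (Set.Icc (0:ℝ) 1)) {j : ℕ} (hj : 2 ≤ j) :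
    fourierCoef S j ^ 2 ≤
      (∫ t in (0:ℝ)..1, |S' t|) ^ 2 * (1 / (j - 3 / 2) - 1 / ((j + 1 : ℕ) - 3 / 2)) := by
  obtain ⟨v, hv, hphi, hv0, hv1, hB⟩ := exists_antideriv_phi hj
  have h := abs_fourierCoef_le hderiv hS'cont hv hphi hv0 hv1 hB
  have hj' : (2 : ℝ) ≤ j := by exact_mod_cast hj
  have hk : (j : ℝ) - 1 ≤ 2 * (j / 2 : ℕ) := by
    have : j ≤ 2 * (j / 2) + 1 := by omega
    have : (j : ℝ) ≤ 2 * (j / 2 : ℕ) + 1 := by exact_mod_cast this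
    linarith
  set k : ℝ := ((j / 2 : ℕ) : ℝ)
  have hk0 : 0 < k := by linarith
  have hpi : (9 : ℝ) ≤ π ^ 2 := by nlinarith [pi_gt_three]
  calc fourierCoef S j ^ 2 = |fourierCoef S j| ^ 2 := (sq_abs _).symm
    _ ≤ (√2 / (π * k) * ∫ t in (0:ℝ)..1, |S' t|) ^ 2 := by gcongr
    _ = (∫ t in (0:ℝ)..1, |S' t|) ^ 2 * (2 / (π ^ 2 * k ^ 2)) := by
      rw [mul_pow, div_pow, mul_pow, sq_sqrt zero_le_two, mul_comm]
    _ ≤ _ := by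
      gcongr
      have hsub : 1 / ((j : ℝ) - 3 / 2) - 1 / ((j + 1 : ℕ) - 3 / 2) =
          1 / ((j - 3 / 2) * (j - 1 / 2)) := by
        have h1 : (j : ℝ) - 3 / 2 ≠ 0 := by linarith
        have h2 : (j : ℝ) - 1 / 2 ≠ 0 := by linarith
        have h3 : ((j + 1 : ℕ) : ℝ) - 3 / 2 = j - 1 / 2 := by push_cast; ring
        rw [h3, div_sub_div _ _ h1 h2]
        congr 1
        ring
      rw [hsub, div_le_div_iff₀ (by positivity) (mul_pos (by linarith) (by linarith))]
      nlinarith [mul_le_mul_of_nonneg_right hpi (sq_nonneg k)]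

theorem sum_range_tail_le_of_telescoping {f g : ℕ → ℝ} {l : ℕ}
    (hfg : ∀ j, l ≤ j → f j ≤ g j - g (j + 1)) (n : ℕ) :
    ∑ j ∈ Finset.range n, (if l ≤ j then f j else 0) ≤ g l - g (max l n) := by
  induction n with
  | zero => simp
  | succ n ih =>
    rw [Finset.sum_range_succ]
    by_cases hn : l ≤ n
    · rw [max_eq_right hn] at ih
      rw [if_pos hn, max_eq_right (hn.trans n.le_succ)]
      linarith [hfg n hn]
    · rw [max_eq_left (by omega)] at ih ⊢
      simpa [hn] using ih

/-- Lemma A.6 : `sup_{l ≥ 2} l ∑_{j ≥ l} θ_j² ≤ 4 |Ṡ|₁²`. -/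
theorem fourier_tail_bound
    (S S' : ℝ → ℝ)
    (hderiv : ∀ t ∈ Set.Icc (0:ℝ) 1, HasDerivWithinAt S (S' t) (Set.Icc (0:ℝ) 1) t)
    (hS'cont : ContinuousOn S' (Set.Icc (0:ℝ) 1)) :
    ∀ l : ℕ, 2 ≤ l →
      (l : ℝ) * (∑' j : ℕ, if l ≤ j then (fourierCoef S j) ^ 2 else 0) ≤
        4 * (∫ t in (0:ℝ)..1, |S' t|) ^ 2 := by
  intro l hl
  set A := ∫ t in (0:ℝ)..1, |S' t|
  have hl' : (2 : ℝ) ≤ l := by exact_mod_cast hl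
  have htail : (∑' j : ℕ, if l ≤ j then fourierCoef S j ^ 2 else 0) ≤ A ^ 2 * (1 / (l - 3 / 2)) := by
    refine Real.tsum_le_of_sum_range_le (fun j => by split_ifs <;> positivity) fun n => ?_
    refine (sum_range_tail_le_of_telescoping (g := fun j => A ^ 2 * (1 / (j - 3 / 2)))
      (fun j hj => ?_) n).trans (sub_le_self _ ?_)
    · rw [← mul_sub]
      exact fourierCoef_sq_le hderiv hS'cont (hl.trans hj)
    · have : (l : ℝ) ≤ (max l n : ℕ) := by exact_mod_cast le_max_left l n
      exact mul_nonneg (sq_nonneg A) (one_div_nonneg.2 (by linarith))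
  have hfrac : (l : ℝ) * (1 / (l - 3 / 2)) ≤ 4 := by
    rw [mul_one_div, div_le_iff₀ (by linarith)]
    linarith
  calc (l : ℝ) * (∑' j : ℕ, if l ≤ j then fourierCoef S j ^ 2 else 0)
      ≤ l * (A ^ 2 * (1 / (l - 3 / 2))) := by gcongr
    _ = l * (1 / (l - 3 / 2)) * A ^ 2 := by ring
    _ ≤ 4 * A ^ 2 := by gcongr
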